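/- Let x₀ > 0, let q : [0,x₀] → ℝ be nonnegative, differentiable and monotone increasing, and let z > 0 satisfy z² > q(x₀). Let φ be the Prüfer angle of q at z, let i ≥ 0 be an integer, D ∈ [π/2, π], and let a ≤ b in (0,x₀] satisfy φ(a) = iπ + π/2 and φ(b) = iπ + π/2 + D; let ψ be the inverse of φ restricted to [a,b], and write A = q(a)/z². Then there exists c₂ ∈ (iπ + π/2, iπ + π/2 + D) such that, writing B = q(ψ(c₂))/z², one has −2·∫ₐᵇ (q(x)/z)·sinφ(x)·cosφ(x)·( ∫ₐˣ (q(s)/z)·sin²φ(s) ds ) dx ≥ −(π/4)·[ (A/(1 − (3/4)·A))·log(1 − (3/4)·A) − 2·(A/(1 − A))·log(1 − A) ] + (π²/(2z²))·( (log(1 − B) − B)/(1 − B)² )·q'(ψ(c₂))/φ'(ψ(c₂)). -/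

import Mathlib

open Real Set

lemma dil_tangent (x y : ℝ) (hx : 0 < x) (hy : 0 < y) (hy1 : y ≤ 1) :
    -log y / y + (log y - 1) / y ^ 2 * (x - y) ≤ -log x / x := by
  obtain ⟨τ, rfl⟩ : ∃ τ, x = τ * y := ⟨x / y, by field_simp⟩
  have hτ : 0 < τ := pos_of_mul_pos_left hx hy.le
  rw [Real.log_mul hτ.ne' hy.ne']
  have h1 : log τ ≤ τ - 1 := Real.log_le_sub_one_of_pos hτ
  have h2 : log y ≤ 0 := Real.log_nonpos hy.le hy1
  have e : -(log τ + log y) / (τ * y) - (-log y / y + (log y - 1) / y ^ 2 * (τ * y - y))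
      = (-log τ - log y * (τ - 1) ^ 2 + τ * (τ - 1)) / (τ * y) := by
    field_simp; ring
  have : 0 ≤ (-log τ - log y * (τ - 1) ^ 2 + τ * (τ - 1)) / (τ * y) := by
    apply div_nonneg _ hx.le
    nlinarith [mul_nonneg (neg_nonneg.2 h2) (sq_nonneg (τ - 1)), sq_nonneg (τ - 1)]
  linarith

lemma dil_pos (A t : ℝ) (hA0 : 0 ≤ A) (hA : A < 1) : 0 < 1 - A * sin t ^ 2 := by
  nlinarith [sin_sq_le_one t, sq_nonneg (sin t)]

lemma dil_cont (A : ℝ) (hA0 : 0 ≤ A) (hA : A < 1) : 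
    Continuous (fun t => A / (1 - A * sin t ^ 2)) := by
  apply Continuous.div (by fun_prop) (by fun_prop)
  intro t; exact (dil_pos A t hA0 hA).ne'

lemma dil_logderiv (A t : ℝ) (hA0 : 0 ≤ A) (hA : A < 1) :
    HasDerivAt (fun t => log (1 - A * sin t ^ 2))
      (-(2 * (A / (1 - A * sin t ^ 2)) * (sin t * cos t))) t := by
  have h := (((hasDerivAt_sin t).fun_pow 2).const_mul A).const_sub 1
  have := h.log (dil_pos A t hA0 hA).ne'
  refine this.congr_deriv ?_
  simp; ring

lemma dil_pi (i : ℕ) : sin ((i : ℝ) * π + π / 2) ^ 2 = 1 ∧ cos ((i : ℝ) * π + π / 2) = 0 ∧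
   sin ((i : ℝ) * π + π / 2 + π / 2) = 0 := by
  have h1 : cos ((i : ℝ) * π + π / 2) = 0 := by
    rw [cos_add_pi_div_two, sin_nat_mul_pi, neg_zero]
  refine ⟨?_, h1, ?_⟩
  · rw [sin_sq, h1]; ring
  · rw [sin_add_pi_div_two, h1]

lemma dil_sin4 (t : ℝ) : HasDerivAt (fun t => 3 / 8 * t - 3 / 8 * (sin t * cos t) 
    - 1 / 4 * (sin t ^ 3 * cos t)) (sin t ^ 4) t := by
  have h := (((hasDerivAt_id t).const_mul (3/8)).sub
    (((hasDerivAt_sin t).mul (hasDerivAt_cos t)).const_mul (3/8))).sub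
    ((((hasDerivAt_sin t).pow 3).mul (hasDerivAt_cos t)).const_mul (1/4))
  refine HasDerivAt.congr_deriv h ?_
  simp
  have := cos_sq' t
  linear_combination (-(3/8) - 3/4 * sin t ^ 2) * this

lemma dil_sin2 (t : ℝ) : HasDerivAt (fun t => 1 / 2 * t - 1 / 2 * (sin t * cos t)) (sin t ^ 2) t := by
  have h := (((hasDerivAt_id t).const_mul (1/2)).sub
    (((hasDerivAt_sin t).mul (hasDerivAt_cos t)).const_mul (1/2)))
  refine HasDerivAt.congr_deriv h ?_
  simp
  have := cos_sq' t
  linear_combination (-(1/2)) * this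

lemma dil_P (A : ℝ) (hA0 : 0 ≤ A) (hA : A < 1) (i : ℕ) :
    π / 4 * (A / (1 - 3 / 4 * A) * (-log (1 - 3 / 4 * A))) ≤
    ∫ t in ((i : ℝ) * π + π / 2)..((i : ℝ) * π + π / 2 + π / 2),
      -(2 * (A / (1 - A * sin t ^ 2)) * (sin t * cos t)) *
        ∫ s in ((i : ℝ) * π + π / 2)..t, A / (1 - A * sin s ^ 2) * sin s ^ 2 := by
  obtain ⟨h1, h2, h3⟩ := dil_pi i
  set α := (i : ℝ) * π + π / 2 with hα
  have hc := dil_cont A hA0 hA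
  have hc' : Continuous (fun t => A / (1 - A * sin t ^ 2) * sin t ^ 2) := hc.mul (by fun_prop)
  have hlog : Continuous (fun t => log (1 - A * sin t ^ 2)) :=
    Continuous.log (by fun_prop) (fun t => (dil_pos A t hA0 hA).ne')
  have hp := intervalIntegral.integral_deriv_mul_eq_sub (a := α) (b := α + π / 2)
    (u := fun t => log (1 - A * sin t ^ 2))
    (v := fun t => ∫ s in α..t, A / (1 - A * sin s ^ 2) * sin s ^ 2)
    (fun t _ => dil_logderiv A t hA0 hA)
    (fun t _ => hc'.integral_hasStrictDerivAt α t |>.hasDerivAt)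
    (by apply Continuous.intervalIntegrable; fun_prop)
    (by apply Continuous.intervalIntegrable; fun_prop)
  have hg : Continuous (fun t => ∫ s in α..t, A / (1 - A * sin s ^ 2) * sin s ^ 2) :=
    intervalIntegral.continuous_primitive (fun _ _ => hc'.intervalIntegrable _ _) _
  rw [intervalIntegral.integral_add (by apply Continuous.intervalIntegrable; fun_prop)
    (by apply Continuous.intervalIntegrable; fun_prop)] at hp
  simp only [h3, intervalIntegral.integral_same] at hp
  norm_num at hp
  set y := 1 - 3 / 4 * A with hy
  have hy0 : 0 < y := by rw [hy]; linarith
  have key : ∫ t in α..(α + π / 2), (A * (-log y / y + (log y - 1) / y ^ 2 * (3 / 4 * A)) * sin t ^ 2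
      + (- A ^ 2 * ((log y - 1) / y ^ 2)) * sin t ^ 4) ≤
      ∫ t in α..(α + π / 2), - (log (1 - A * sin t ^ 2) * (A / (1 - A * sin t ^ 2) * sin t ^ 2)) := by
    apply intervalIntegral.integral_mono_on (by linarith [pi_pos])
    · apply Continuous.intervalIntegrable; fun_prop
    · apply Continuous.intervalIntegrable; fun_prop
    · intro t _
      have := dil_tangent (1 - A * sin t ^ 2) y (dil_pos A t hA0 hA) hy0 (by rw [hy]; linarith)
      have := mul_le_mul_of_nonneg_left this (mul_nonneg hA0 (sq_nonneg (sin t)))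
      calc _ = A * sin t ^ 2 * (-log y / y + (log y - 1) / y ^ 2 * (1 - A * sin t ^ 2 - y)) := by
            rw [show 1 - A * sin t ^ 2 - y = 3 / 4 * A - A * sin t ^ 2 by rw [hy]; ring]; ring
        _ ≤ _ := this
        _ = _ := by ring
  have s2 : ∫ t in α..(α + π / 2), sin t ^ 2 = π / 4 := by
    rw [intervalIntegral.integral_eq_sub_of_hasDerivAt (fun t _ => dil_sin2 t)
      (by apply Continuous.intervalIntegrable; fun_prop), h2, h3]; ring
  have s4 : ∫ t in α..(α + π / 2), sin t ^ 4 = 3 * π / 16 := by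
    rw [intervalIntegral.integral_eq_sub_of_hasDerivAt (fun t _ => dil_sin4 t)
      (by apply Continuous.intervalIntegrable; fun_prop), h2, h3]; ring
  rw [intervalIntegral.integral_add (by apply Continuous.intervalIntegrable; fun_prop)
    (by apply Continuous.intervalIntegrable; fun_prop), intervalIntegral.integral_const_mul,
    intervalIntegral.integral_const_mul, s2, s4, intervalIntegral.integral_neg] at key
  simp only [neg_mul, intervalIntegral.integral_neg] at hp ⊢
  have e : π / 4 * (A / y * -log y) = A * (-log y / y + (log y - 1) / y ^ 2 * (3 / 4 * A)) * (π / 4) 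
    + (- A ^ 2 * ((log y - 1) / y ^ 2)) * (3 * π / 16) := by ring
  rw [e]
  linarith

lemma dil_low (A z Q y : ℝ) (h : 0 < 1 - A * y) (hQ : A * z ≤ Q) :
    A / (1 - A * y) * (z - Q * y) ≤ Q := by
  rw [div_mul_eq_mul_div, div_le_iff₀ h]; linarith

lemma dil_up (A z Q y : ℝ) (h : 0 < 1 - A * y) (hQ : Q ≤ A * z) :
    Q ≤ A / (1 - A * y) * (z - Q * y) := by
  rw [div_mul_eq_mul_div, le_div_iff₀ h]; linarith

set_option maxHeartbeats 2000000 in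
/-- Lemma 3.5: lower bound for the double-integral term, with a mean value point
c₂; here φ'(ψ(c₂)) = z − q(ψ(c₂))/z·sin²(φ(ψ(c₂))) by the Prüfer ODE. -/
theorem double_integral_term_lower_bound
    (x₀ : ℝ) (hx₀ : 0 < x₀)
    (q q' : ℝ → ℝ)
    (hqnonneg : ∀ x ∈ Icc 0 x₀, 0 ≤ q x)
    (hqdiff : ∀ x ∈ Icc 0 x₀, HasDerivAt q (q' x) x)
    (hmono : MonotoneOn q (Icc 0 x₀))
    (z : ℝ) (hz : 0 < z) (hsup : q x₀ < z ^ 2)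
    (φ : ℝ → ℝ) (hφ0 : φ 0 = 0)
    (hφODE : ∀ x ∈ Icc 0 x₀, HasDerivAt φ (z - q x / z * Real.sin (φ x) ^ 2) x)
    (i : ℕ) (D : ℝ) (hD : D ∈ Icc (π / 2) π)
    (a b : ℝ) (ha : a ∈ Ioc 0 x₀) (hb : b ∈ Ioc 0 x₀) (hab : a ≤ b)
    (hφa : φ a = i * π + π / 2) (hφb : φ b = i * π + π / 2 + D)
    (ψ : ℝ → ℝ)
    (hψ : ∀ t ∈ Icc (φ a) (φ b), ψ t ∈ Icc a b ∧ φ (ψ t) = t) :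
    ∃ c₂ ∈ Ioo ((i : ℝ) * π + π / 2) ((i : ℝ) * π + π / 2 + D),
      -2 * (∫ x in a..b, (q x / z) * Real.sin (φ x) * Real.cos (φ x) *
            (∫ s in a..x, (q s / z) * Real.sin (φ s) ^ 2)) ≥
        -(π / 4) *
            (((q a / z ^ 2) / (1 - 3 / 4 * (q a / z ^ 2))) *
                Real.log (1 - 3 / 4 * (q a / z ^ 2))
              - 2 * ((q a / z ^ 2) / (1 - q a / z ^ 2)) * Real.log (1 - q a / z ^ 2))
          + π ^ 2 / (2 * z ^ 2) *
            ((Real.log (1 - q (ψ c₂) / z ^ 2) - q (ψ c₂) / z ^ 2) /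
                (1 - q (ψ c₂) / z ^ 2) ^ 2) *
            (q' (ψ c₂) / (z - q (ψ c₂) / z * Real.sin (φ (ψ c₂)) ^ 2)) := by
  have hsub : ∀ x ∈ Icc a b, x ∈ Icc 0 x₀ := fun x hx => ⟨ha.1.le.trans hx.1, hx.2.trans hb.2⟩
  obtain ⟨h1, h2, h3⟩ := dil_pi i
  have hpi := pi_pos
  set α := (i : ℝ) * π + π / 2 with hα
  have hz2 : 0 < z ^ 2 := by positivity
  set A := q a / z ^ 2 with hAdef
  set E := q b / z ^ 2 with hEdef
  have haI : a ∈ Icc a b := ⟨le_rfl, hab⟩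
  have hbI : b ∈ Icc a b := ⟨hab, le_rfl⟩
  have hqlt : ∀ x ∈ Icc a b, q x / z ^ 2 < 1 := fun x hx => by
    rw [div_lt_one hz2]
    exact (hmono (hsub x hx) ⟨hx₀.le, le_rfl⟩ (hsub x hx).2).trans_lt hsup
  have hq0 : ∀ x ∈ Icc a b, 0 ≤ q x / z ^ 2 := fun x hx =>
    div_nonneg (hqnonneg x (hsub x hx)) hz2.le
  have hA0 : 0 ≤ A := hq0 a haI
  have hA1 : A < 1 := hqlt a haI
  have hE0 : 0 ≤ E := hq0 b hbI
  have hE1 : E < 1 := hqlt b hbI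
  have hAz : A * z = q a / z := by rw [hAdef]; field_simp
  have hEz : E * z = q b / z := by rw [hEdef]; field_simp
  have hlow : ∀ x ∈ Icc a b, A * z ≤ q x / z := fun x hx => by
    rw [hAz]; gcongr; exact hmono (hsub a haI) (hsub x hx) hx.1
  have hup : ∀ x ∈ Icc a b, q x / z ≤ E * z := fun x hx => by
    rw [hEz]; gcongr; exact hmono (hsub x hx) (hsub b hbI) hx.2
  have hd : ∀ x ∈ Icc a b, HasDerivAt φ (z - q x / z * sin (φ x) ^ 2) x :=
    fun x hx => hφODE x (hsub x hx)
  have hdpos : ∀ x ∈ Icc a b, 0 < z - q x / z * sin (φ x) ^ 2 := fun x hx => by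
    have := dil_pos _ (φ x) (hq0 x hx) (hqlt x hx)
    have e : z - q x / z * sin (φ x) ^ 2 = z * (1 - q x / z ^ 2 * sin (φ x) ^ 2) := by
      field_simp
    rw [e]; positivity
  have hφc : ContinuousOn φ (Icc a b) := fun x hx => (hd x hx).continuousAt.continuousWithinAt
  have hqc : ContinuousOn q (Icc a b) := fun x hx =>
    (hqdiff x (hsub x hx)).continuousAt.continuousWithinAt
  have hqzc : ContinuousOn (fun x => q x / z) (Icc a b) := hqc.div_const z
  have hsc : ContinuousOn (fun x => sin (φ x)) (Icc a b) := continuous_sin.comp_continuousOn hφc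
  have hcc : ContinuousOn (fun x => cos (φ x)) (Icc a b) := continuous_cos.comp_continuousOn hφc
  have hdc : ContinuousOn (fun x => z - q x / z * sin (φ x) ^ 2) (Icc a b) :=
    continuousOn_const.sub (hqzc.mul (hsc.pow 2))
  have hsm : StrictMonoOn φ (Icc a b) := by
    apply strictMonoOn_of_deriv_pos (convex_Icc a b) hφc
    intro x hx
    rw [interior_Icc] at hx
    rw [(hd x (Ioo_subset_Icc_self hx)).deriv]
    exact hdpos x (Ioo_subset_Icc_self hx)
  have hab' : a < b := by
    rcases hab.eq_or_lt with h | h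
    · exfalso; rw [h, hφb] at hφa; linarith [hD.1]
    · exact h
  have hcv : ∀ (g : ℝ → ℝ), Continuous g → ∀ u ∈ Icc a b, ∀ v ∈ Icc a b, u ≤ v →
      ∫ x in u..v, g (φ x) * (z - q x / z * sin (φ x) ^ 2) = ∫ t in (φ u)..(φ v), g t := by
    intro g hg u hu v hv huv
    have hs : uIcc u v ⊆ Icc a b := by
      rw [uIcc_of_le huv]; exact Icc_subset_Icc hu.1 hv.2
    exact intervalIntegral.integral_comp_mul_deriv' (fun x hx => hd x (hs hx)) (hdc.mono hs)
      hg.continuousOn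
  have hii : ∀ (f : ℝ → ℝ), ContinuousOn f (Icc a b) → ∀ u ∈ Icc a b, ∀ v ∈ Icc a b, u ≤ v →
      IntervalIntegrable f MeasureTheory.volume u v := by
    intro f hf u hu v hv huv
    apply ContinuousOn.intervalIntegrable
    apply hf.mono
    rw [uIcc_of_le huv]; exact Icc_subset_Icc hu.1 hv.2
  have hcA : Continuous (fun t => A / (1 - A * sin t ^ 2)) := dil_cont A hA0 hA1
  have hcE : Continuous (fun t => E / (1 - E * sin t ^ 2)) := dil_cont E hE0 hE1
  have hcA' : Continuous (fun t => A / (1 - A * sin t ^ 2) * sin t ^ 2) := hcA.mul (by fun_prop)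
  set G : ℝ → ℝ := fun x => ∫ s in a..x, (q s / z) * Real.sin (φ s) ^ 2 with hG
  have hGi : ContinuousOn (fun s => (q s / z) * Real.sin (φ s) ^ 2) (Icc a b) :=
    hqzc.mul (hsc.pow 2)
  have hGc : ContinuousOn G (Icc a b) := by
    have := intervalIntegral.continuousOn_primitive_interval (a := a) (b := b)
      (f := fun s => (q s / z) * Real.sin (φ s) ^ 2) (μ := MeasureTheory.volume)
      (by rw [uIcc_of_le hab]; exact hGi.integrableOn_Icc)
    rwa [uIcc_of_le hab] at this
  have hqz0 : ∀ x ∈ Icc a b, 0 ≤ q x / z := fun x hx => div_nonneg (hqnonneg x (hsub x hx)) hz.le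
  have hgA0 : ∀ t, 0 ≤ A / (1 - A * sin t ^ 2) := fun t => div_nonneg hA0 (dil_pos A t hA0 hA1).le
  have hGlow : ∀ x ∈ Icc a b,
      ∫ s in α..(φ x), A / (1 - A * sin s ^ 2) * sin s ^ 2 ≤ G x := by
    intro x hx
    rw [← hφa, ← hcv _ hcA' a haI x hx hx.1]
    apply intervalIntegral.integral_mono_on hx.1
    · apply hii _ _ a haI x hx hx.1
      exact (hcA'.comp_continuousOn hφc).mul hdc
    · exact hii _ hGi a haI x hx hx.1
    · intro s hs
      have hs' : s ∈ Icc a b := ⟨hs.1, hs.2.trans hx.2⟩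
      have := dil_low A z (q s / z) (sin (φ s) ^ 2) (dil_pos A _ hA0 hA1) (hlow s hs')
      nlinarith [sq_nonneg (sin (φ s))]
  have hGup : G b ≤ E / (1 - E) * (π / 2) := by
    have hE1' : 0 < 1 - E := by linarith
    have c1 : Continuous (fun t => E / (1 - E) * sin t ^ 2) := by fun_prop
    have : G b ≤ ∫ t in (φ a)..(φ b), E / (1 - E) * sin t ^ 2 := by
      rw [← hcv _ c1 a haI b hbI hab]
      apply intervalIntegral.integral_mono_on hab
      · exact hii _ hGi a haI b hbI hab
      · apply hii _ _ a haI b hbI hab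
        exact (c1.comp_continuousOn hφc).mul hdc
      · intro s hs
        have h5 := dil_up E z (q s / z) (sin (φ s) ^ 2) (dil_pos E _ hE0 hE1) (hup s hs)
        have h6 : E / (1 - E * sin (φ s) ^ 2) ≤ E / (1 - E) := by
          apply div_le_div_of_nonneg_left hE0 hE1'
          nlinarith [sin_sq_le_one (φ s)]
        have h7 := h5.trans (mul_le_mul_of_nonneg_right h6 (hdpos s hs).le)
        nlinarith [mul_le_mul_of_nonneg_right h7 (sq_nonneg (sin (φ s)))]
    refine this.trans ?_
    rw [intervalIntegral.integral_const_mul]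
    apply mul_le_mul_of_nonneg_left _ (div_nonneg hE0 hE1'.le)
    rw [hφa, hφb]
    have i1 : ∫ t in α..(α + D), sin t ^ 2 ≤ ∫ t in α..(α + π), sin t ^ 2 := by
      apply intervalIntegral.integral_mono_interval le_rfl (by linarith [hD.1]) (by linarith [hD.2])
      · exact Filter.Eventually.of_forall (fun t => sq_nonneg _)
      · apply Continuous.intervalIntegrable; fun_prop
    refine i1.trans (le_of_eq ?_)
    rw [intervalIntegral.integral_eq_sub_of_hasDerivAt (fun t _ => dil_sin2 t)
      (by apply Continuous.intervalIntegrable; fun_prop), h2, cos_add_pi, h2]; ring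
  obtain ⟨m, hm, hφm⟩ : ∃ m ∈ Icc a b, φ m = α + π / 2 := by
    have := intermediate_value_Icc hab hφc
    exact this ⟨by rw [hφa]; linarith, by rw [hφb]; linarith [hD.1]⟩
  have hGmono : ∀ x ∈ Icc a b, G x ≤ G b := by
    intro x hx
    apply intervalIntegral.integral_mono_interval le_rfl hx.1 hx.2
    · rw [Filter.EventuallyLE, MeasureTheory.ae_restrict_iff' measurableSet_Ioc]
      exact Filter.Eventually.of_forall (fun s hs =>
        mul_nonneg (hqz0 s (Ioc_subset_Icc_self hs)) (sq_nonneg _))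
    · exact hii _ hGi a haI b hbI hab
  have hG0 : ∀ x ∈ Icc a b, 0 ≤ G x := by
    intro x hx
    apply intervalIntegral.integral_nonneg hx.1
    intro s hs
    exact mul_nonneg (hqz0 s ⟨hs.1, hs.2.trans hx.2⟩) (sq_nonneg _)
  have hWc : ContinuousOn (fun x => (q x / z) * Real.sin (φ x) * Real.cos (φ x) * G x) (Icc a b) :=
    ((hqzc.mul hsc).mul hcc).mul hGc
  have hsc2 : ∀ t, sin (α + t) * cos (α + t) = -(sin t * cos t) := by
    intro t
    rw [sin_add α t, cos_add α t, h2]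
    linear_combination (-(sin t * cos t)) * h1
  have hP : π / 4 * (A / (1 - 3 / 4 * A) * (-log (1 - 3 / 4 * A))) ≤
      ∫ x in a..m, -2 * ((q x / z) * Real.sin (φ x) * Real.cos (φ x) * G x) := by
    refine (dil_P A hA0 hA1 i).trans ?_
    rw [← hα]
    have hg : Continuous (fun t => ∫ s in α..t, A / (1 - A * sin s ^ 2) * sin s ^ 2) :=
      intervalIntegral.continuous_primitive (fun _ _ => hcA'.intervalIntegrable _ _) _
    have hK : Continuous (fun t => -(2 * (A / (1 - A * sin t ^ 2)) * (sin t * cos t)) *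
        ∫ s in α..t, A / (1 - A * sin s ^ 2) * sin s ^ 2) := by fun_prop
    have e := hcv _ hK a haI m hm hm.1
    rw [hφa, hφm] at e
    rw [← e]
    apply intervalIntegral.integral_mono_on hm.1
    · apply hii _ _ a haI m hm hm.1
      exact (hK.comp_continuousOn hφc).mul hdc
    · exact hii _ (continuousOn_const.mul hWc) a haI m hm hm.1
    · intro x hx
      have hx' : x ∈ Icc a b := ⟨hx.1, hx.2.trans hm.2⟩
      have k1 := dil_low A z (q x / z) (sin (φ x) ^ 2) (dil_pos A _ hA0 hA1) (hlow x hx')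
      have k2 := hGlow x hx'
      have k3 : 0 ≤ -(sin (φ x) * cos (φ x)) := by
        have l1 : φ a ≤ φ x := hsm.monotoneOn haI hx' hx.1
        have l2 : φ x ≤ φ m := hsm.monotoneOn hx' hm hx.2
        have := hsc2 (φ x - α)
        rw [add_sub_cancel] at this
        rw [this, neg_neg]
        apply mul_nonneg
        · apply sin_nonneg_of_nonneg_of_le_pi <;> linarith
        · apply cos_nonneg_of_neg_pi_div_two_le_of_le <;> linarith
      set g := ∫ s in α..(φ x), A / (1 - A * sin s ^ 2) * sin s ^ 2
      have k4 : 0 ≤ A / (1 - A * sin (φ x) ^ 2) * (z - q x / z * sin (φ x) ^ 2) :=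
        mul_nonneg (hgA0 _) (hdpos x hx').le
      have k5 := mul_le_mul k1 k2 (by
        apply intervalIntegral.integral_nonneg
        · rw [← hφa]; exact hsm.monotoneOn haI hx' hx.1
        · intro s _; exact mul_nonneg (hgA0 s) (sq_nonneg _)) (hqz0 x hx')
      have k6 := mul_le_mul_of_nonneg_right k5 k3
      calc _ = 2 * (A / (1 - A * sin (φ x) ^ 2) * (z - q x / z * sin (φ x) ^ 2) * g *
              -(sin (φ x) * cos (φ x))) := by ring
        _ ≤ 2 * (q x / z * G x * -(sin (φ x) * cos (φ x))) := by linarith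
        _ = _ := by ring
  have hN : -(π / 2 * (E / (1 - E) * (-log (1 - E)))) ≤
      ∫ x in m..b, -2 * ((q x / z) * Real.sin (φ x) * Real.cos (φ x) * G x) := by
    have hK : Continuous (fun t => -(2 * (E / (1 - E * sin t ^ 2)) * (sin t * cos t))) := by
      fun_prop
    have e := hcv _ hK m hm b hbI hm.2
    rw [intervalIntegral.integral_eq_sub_of_hasDerivAt (fun t _ => dil_logderiv E t hE0 hE1)
      (hK.intervalIntegrable _ _), hφm, h3] at e
    rw [show 1 - E * 0 ^ 2 = 1 by ring, log_one, sub_zero] at e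
    have l0 : log (1 - E) ≤ log (1 - E * sin (φ b) ^ 2) := by
      apply Real.log_le_log (by linarith)
      nlinarith [sin_sq_le_one (φ b)]
    have l1 : log (1 - E) ≤ 0 := Real.log_nonpos (by linarith) (by linarith)
    have l2 : -(π / 2 * (E / (1 - E) * (-log (1 - E)))) ≤
        ∫ x in m..b, G b * (-(2 * (E / (1 - E * sin (φ x) ^ 2)) * (sin (φ x) * cos (φ x))) *
          (z - q x / z * sin (φ x) ^ 2)) := by
      rw [intervalIntegral.integral_const_mul]
      rw [e]
      have v1 := mul_le_mul_of_nonneg_left l0 (hG0 b hbI)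
      have v2 := mul_le_mul_of_nonneg_right hGup (neg_nonneg.2 l1)
      refine le_trans ?_ v1
      linarith only [v2]
    refine l2.trans ?_
    apply intervalIntegral.integral_mono_on hm.2
    · apply hii _ _ m hm b hbI hm.2
      exact continuousOn_const.mul ((hK.comp_continuousOn hφc).mul hdc)
    · exact hii _ (continuousOn_const.mul hWc) m hm b hbI hm.2
    · intro x hx
      have hx' : x ∈ Icc a b := ⟨hm.1.trans hx.1, hx.2⟩
      have k1 := dil_up E z (q x / z) (sin (φ x) ^ 2) (dil_pos E _ hE0 hE1) (hup x hx')
      have k2 := hGmono x hx'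
      have k3 : 0 ≤ (sin (φ x) * cos (φ x)) := by
        have l1 : φ m ≤ φ x := hsm.monotoneOn hm hx' hx.1
        have l2 : φ x ≤ φ b := hsm.monotoneOn hx' hbI hx.2
        have hD2 := hD.2
        have := hsc2 (φ x - α)
        rw [add_sub_cancel] at this
        rw [this, ← mul_neg]
        apply mul_nonneg
        · apply sin_nonneg_of_nonneg_of_le_pi <;> linarith
        · rw [neg_nonneg]; apply cos_nonpos_of_pi_div_two_le_of_le <;> linarith
      have k5 := mul_le_mul k1 k2 (hG0 x hx') ((hqz0 x hx').trans k1)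
      have k6 := mul_le_mul_of_nonneg_right k5 k3
      calc _ = -2 * (E / (1 - E * sin (φ x) ^ 2) * (z - q x / z * sin (φ x) ^ 2) * G b *
              (sin (φ x) * cos (φ x))) := by ring
        _ ≤ -2 * (q x / z * G x * (sin (φ x) * cos (φ x))) := by linarith
        _ = _ := by ring
  have hsum : -2 * (∫ x in a..b, (q x / z) * Real.sin (φ x) * Real.cos (φ x) * G x) =
      (∫ x in a..m, -2 * ((q x / z) * Real.sin (φ x) * Real.cos (φ x) * G x)) +
      ∫ x in m..b, -2 * ((q x / z) * Real.sin (φ x) * Real.cos (φ x) * G x) := by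
    rw [← intervalIntegral.integral_const_mul, intervalIntegral.integral_add_adjacent_intervals]
    · exact hii _ (continuousOn_const.mul hWc) a haI m hm hm.1
    · exact hii _ (continuousOn_const.mul hWc) m hm b hbI hm.2
  have hHd : ∀ x ∈ Icc a b, HasDerivAt
      (fun x => log (1 - q x / z ^ 2) - log (1 - q x / z ^ 2) / (1 - q x / z ^ 2))
      (-((log (1 - q x / z ^ 2) - q x / z ^ 2) / (1 - q x / z ^ 2) ^ 2) * (q' x / z ^ 2)) x := by
    intro x hx
    have hp : 0 < 1 - q x / z ^ 2 := by linarith [hqlt x hx]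
    have d0 := ((hqdiff x (hsub x hx)).div_const (z ^ 2)).const_sub 1
    have d1 := d0.log hp.ne'
    refine HasDerivAt.congr_deriv (d1.sub (d1.div d0 hp.ne')) ?_
    set p := q x / z ^ 2
    have hp' := hp.ne'
    field_simp
    ring
  obtain ⟨c, hc, hcE⟩ := exists_ratio_hasDerivAt_eq_ratio_slope
    (fun x => log (1 - q x / z ^ 2) - log (1 - q x / z ^ 2) / (1 - q x / z ^ 2))
    (fun x => -((log (1 - q x / z ^ 2) - q x / z ^ 2) / (1 - q x / z ^ 2) ^ 2) * (q' x / z ^ 2))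
    hab' (fun x hx => (hHd x hx).continuousAt.continuousWithinAt)
    (fun x hx => hHd x (Ioo_subset_Icc_self hx))
    φ (fun x => z - q x / z * sin (φ x) ^ 2) hφc
    (fun x hx => hd x (Ioo_subset_Icc_self hx))
  have hcI := Ioo_subset_Icc_self hc
  have hc1 : φ a < φ c := hsm haI hcI hc.1
  have hc2 : φ c < φ b := hsm hcI hbI hc.2
  have hψc : ψ (φ c) = c := by
    obtain ⟨m1, m2⟩ := hψ (φ c) ⟨hc1.le, hc2.le⟩
    exact hsm.injOn m1 hcI m2
  refine ⟨φ c, ⟨by rwa [hφa] at hc1, by rwa [hφb] at hc2⟩, ?_⟩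
  rw [hψc, hsum, ge_iff_le]
  have hdc0 := hdpos c hcI
  rw [hφa, hφb, add_sub_cancel_left] at hcE
  simp only [← hAdef, ← hEdef] at hcE
  set p := q c / z ^ 2 with hp
  set d := z - q c / z * sin (φ c) ^ 2 with hdd
  set T := ((log (1 - p) - p) / (1 - p) ^ 2) with hT
  have hA1' : 1 - A ≠ 0 := by linarith
  have hE1' : 1 - E ≠ 0 := by linarith
  have eH : ∀ B : ℝ, 1 - B ≠ 0 → log (1 - B) - log (1 - B) / (1 - B) =
      B / (1 - B) * (-log (1 - B)) := by
    intro B hB; field_simp; ring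
  rw [eH A hA1', eH E hE1'] at hcE
  have eT : T * (q' c / z ^ 2 / d) = -((E / (1 - E) * (-log (1 - E)) -
      A / (1 - A) * (-log (1 - A))) / D) := by
    have hD0 : D ≠ 0 := by linarith [hD.1]
    field_simp at hcE ⊢
    linear_combination (-1 : ℝ) * hcE
  have eq2 : π ^ 2 / (2 * z ^ 2) * T * (q' c / d) = π ^ 2 / 2 * (T * (q' c / z ^ 2 / d)) := by
    field_simp
  have hHmono : 0 ≤ E / (1 - E) * (-log (1 - E)) - A / (1 - A) * (-log (1 - A)) := by
    have hAE : A ≤ E := by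
      have := hlow b hbI
      rw [← hEz] at this
      exact le_of_mul_le_mul_right this hz
    have u1 : A / (1 - A) ≤ E / (1 - E) := by
      rw [div_le_div_iff₀ (by linarith) (by linarith)]; nlinarith
    have u2 : log (1 - E) ≤ log (1 - A) := Real.log_le_log (by linarith) (by linarith)
    have u3 : log (1 - A) ≤ 0 := Real.log_nonpos (by linarith) (by linarith)
    have := mul_le_mul u1 (neg_le_neg u2) (neg_nonneg.2 u3)
      (div_nonneg hE0 (by linarith))
    linarith
  rw [eq2, eT]
  set HH := E / (1 - E) * (-log (1 - E)) - A / (1 - A) * (-log (1 - A)) with hHH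
  have f1 : π / 2 * HH ≤ π ^ 2 / 2 * (HH / D) := by
    have hD0 : 0 < D := by linarith [hD.1]
    have : π ^ 2 / 2 * (HH / D) = π / 2 * HH * (π / D) := by ring
    rw [this]
    apply le_mul_of_one_le_right (by positivity)
    rw [one_le_div hD0]; exact hD.2
  have f2 := add_le_add hP hN
  refine le_trans ?_ f2
  have f3 : π ^ 2 / 2 * -(HH / D) ≤ -(π / 2 * HH) := by linarith
  refine (add_le_add_right f3 _).trans (le_of_eq ?_)
  rw [hHH]
  ring
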